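/- Let ψ ∈ C_c^∞(ℝ) with supp ψ ⊂ {1/2 ≤ |ξ| ≤ 2} and Σ_{k∈ℤ} ψ(2^k ξ) = 1 for all ξ ≠ 0; set ψ_k(ξ) = ψ(2^k ξ). Suppose there exists T₀ > 0 such that for every ε₀ ∈ (0,1) there exist h₀ ∈ (0,1) and C₀ > 0 for which the frequency-localized observability ‖ψ_k(hDₓ)u₀‖²_{L²(𝕋)} ≤ C₀ ∫₀^{T₀} ‖g · ψ_k(hDₓ)(Sʰ(t)u₀)‖²_{L²(𝕋)} dt holds for all k ∈ ℤ, all h ∈ (0,h₀) with 2^k h ≤ ε₀, and all u₀ ∈ L²₀(𝕋). Then there exist C > 0 and h₁ ∈ (0,1) such that for all h ∈ (0,h₁) and all u₀ ∈ L²₀(𝕋), ‖u₀‖²_{L²(𝕋)} ≤ C ∫₀^{T₀} ‖g · Sʰ(t)u₀‖²_{L²(𝕋)} dt + C ‖u₀‖²_{H^{−1}(𝕋)}. -/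

import Mathlib

open MeasureTheory Real Filter

noncomputable section

instance : Fact (0 < 2 * Real.pi) := ⟨by positivity⟩

/-- The torus `𝕋 = ℝ/2πℤ`. -/
abbrev Torus := AddCircle (2 * Real.pi)

/-- `L²(𝕋)`. -/
abbrev L2T := Lp ℂ 2 (volume : Measure Torus)

/-- Fourier coefficient `û(k) = (1/2π) ∫_𝕋 u(x) e^{-ikx} dx`. -/
def fc (u : Torus → ℂ) (k : ℤ) : ℂ :=
  (1 / (2 * Real.pi)) * ∫ x : Torus, fourier (-k) x * u x

/-- Membership in `L²₀(𝕋)`: the mean `û(0)` vanishes. -/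
def MeanZero (u : L2T) : Prop := fc (u : Torus → ℂ) 0 = 0

/-- The squared `H⁻¹(𝕋)` norm `‖u‖²_{H⁻¹} = Σ_k (1+k²)⁻¹ |û(k)|²`. -/
def Hneg1Sq (u : L2T) : ℝ := ∑' k : ℤ, (1 + (k : ℝ) ^ 2)⁻¹ * ‖fc (u : Torus → ℂ) k‖ ^ 2

/-- Squared `L²` norm of the pointwise product `g · v`. -/
def gMulNormSq (g : Torus → ℝ) (v : L2T) : ℝ :=
  ∫ x : Torus, ‖(g x : ℂ) * (v : Torus → ℂ) x‖ ^ 2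

/-- Spectral characterization of the unitary group `S_λ(t)` on `L²₀(𝕋)` solving
`∂ₜu + ∂ₓ³u - λ²∂ₓ⁻¹u = 0`: `(S_λ(t)u)^(k) = e^{it(k³ - λ²/k)} û(k)` for `k ≠ 0`. -/
def IsLamGroup (lam : ℝ) (S : ℝ → L2T →L[ℂ] L2T) : Prop :=
  ∀ t : ℝ, ∀ u : L2T, MeanZero u →
    MeanZero (S t u) ∧
      ∀ k : ℤ, k ≠ 0 →
        fc (S t u : Torus → ℂ) k =
          Complex.exp (Complex.I * (t : ℂ) * ((k : ℂ) ^ 3 - (lam : ℂ) ^ 2 / (k : ℂ))) *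
            fc (u : Torus → ℂ) k

/-- Spectral characterization of the semiclassical unitary group `Sʰ(t)` on `L²₀(𝕋)` solving
`h∂ₜu + (h∂ₓ)³u - (h∂ₓ)⁻¹u = 0`: `(Sʰ(t)u)^(k) = e^{it(h²k³ - 1/(h²k))} û(k)` for `k ≠ 0`. -/
def IsSemiGroup (h : ℝ) (S : ℝ → L2T →L[ℂ] L2T) : Prop :=
  ∀ t : ℝ, ∀ u : L2T, MeanZero u →
    MeanZero (S t u) ∧
      ∀ k : ℤ, k ≠ 0 →
        fc (S t u : Torus → ℂ) k =
          Complex.exp (Complex.I * (t : ℂ) *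
              ((h : ℂ) ^ 2 * (k : ℂ) ^ 3 - 1 / ((h : ℂ) ^ 2 * (k : ℂ)))) *
            fc (u : Torus → ℂ) k

/-- `(𝒢 v)(x) = g(x) (v(x) - ∫_𝕋 g(x') v(x') dx')` (a.e.). -/
def IsG (g : Torus → ℝ) (G : L2T →L[ℂ] L2T) : Prop :=
  ∀ v : L2T, ∀ᵐ x ∂(volume : Measure Torus),
    (G v : Torus → ℂ) x =
      (g x : ℂ) * ((v : Torus → ℂ) x - ∫ x' : Torus, (g x' : ℂ) * (v : Torus → ℂ) x')

/-- The Fourier multiplier `m(hDₓ)`: `(m(hDₓ)u)^(k) = m(hk) û(k)`. -/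
def IsMult (m : ℝ → ℝ) (h : ℝ) (M : L2T →L[ℂ] L2T) : Prop :=
  ∀ u : L2T, ∀ k : ℤ, fc (M u : Torus → ℂ) k = (m (h * k) : ℂ) * fc (u : Torus → ℂ) k


theorem fc_eq_fourierCoeff (u : Torus → ℂ) (k : ℤ) : fc u k = fourierCoeff u k := by
  rw [fc, fourierCoeff, AddCircle.integral_haarAddCircle]
  simp [Complex.real_smul]

theorem fc_congr_ae {u v : Torus → ℂ} (h : u =ᵐ[volume] v) (k : ℤ) : fc u k = fc v k := by
  unfold fc
  congr 1
  refine integral_congr_ae ?_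
  filter_upwards [h] with x hx
  rw [hx]

theorem norm_sq_eq_integral_norm_sq (u : L2T) : ‖u‖ ^ 2 = ∫ x : Torus, ‖u x‖ ^ 2 := by
  have h := congr_arg RCLike.re (L2.inner_def (𝕜 := ℂ) u u)
  rw [← integral_re (L2.integrable_inner u u)] at h
  simpa only [← norm_sq_eq_re_inner] using h

/-- Parseval's identity on `L²(𝕋)` with the measure of total mass `2π`. -/
theorem hasSum_sq_fc (u : L2T) :
    HasSum (fun k : ℤ => ‖fc u k‖ ^ 2) ((2 * π)⁻¹ * ‖u‖ ^ 2) := by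
  have hm : MemLp (u : Torus → ℂ) 2 AddCircle.haarAddCircle := (Lp.memLp u).haarAddCircle
  have h := hasSum_sq_fourierCoeff hm.toLp
  have e1 : ∀ k, fourierCoeff (hm.toLp : Torus → ℂ) k = fc u k := fun k => by
    rw [fc_eq_fourierCoeff, fourierCoeff_congr_ae hm.coeFn_toLp]
  have e2 : ∫ t : Torus, ‖(hm.toLp : Torus → ℂ) t‖ ^ 2 ∂AddCircle.haarAddCircle
      = (2 * π)⁻¹ * ‖u‖ ^ 2 := by
    rw [integral_congr_ae (g := fun t => ‖u t‖ ^ 2)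
      (by filter_upwards [hm.coeFn_toLp] with x hx; rw [hx]), AddCircle.integral_haarAddCircle,
      smul_eq_mul, norm_sq_eq_integral_norm_sq]
  simpa only [e1, e2] using h

/-- The exponential `e^{ikx}` as an element of `L²(𝕋)`. -/
def expL2 (k : ℤ) : L2T := ContinuousMap.toLp 2 volume ℂ (fourier k)

/-- The Fourier coefficient as a continuous linear functional. -/
def fcCLM (k : ℤ) : L2T →L[ℂ] ℂ := ((2 * π : ℝ)⁻¹ : ℂ) • innerSL ℂ (expL2 k)

theorem fcCLM_apply (k : ℤ) (u : L2T) : fcCLM k u = fc u k := by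
  simp only [fcCLM, smul_apply, innerSL_apply_apply, L2.inner_def, fc]
  rw [smul_eq_mul]
  congr 1
  · simp
  · refine integral_congr_ae ?_
    filter_upwards [ContinuousMap.coeFn_toLp (p := 2) (𝕜 := ℂ) (volume : Measure Torus) (fourier k)] with x hx
    rw [expL2, hx]
    simp [mul_comm]

theorem fc_expL2 (n k : ℤ) : fc (expL2 n) k = if k = n then 1 else 0 := by
  rw [expL2, fc_congr_ae (ContinuousMap.coeFn_toLp (volume : Measure Torus) (fourier n)),
    fc_eq_fourierCoeff]
  simp [fourierCoeff_fourier, Pi.single_apply]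

theorem exists_multiplier (m : ℤ → ℝ) (hm : (Function.support m).Finite) :
    ∃ M : L2T →L[ℂ] L2T, ∀ (u : L2T) (k : ℤ), fc (M u) k = (m k : ℂ) * fc u k := by
  refine ⟨∑ n ∈ hm.toFinset, (m n : ℂ) • (fcCLM n).smulRight (expL2 n), fun u k => ?_⟩
  rw [← fcCLM_apply]
  simp only [sum_apply, map_sum, smul_apply, map_smul,
    ContinuousLinearMap.smulRight_apply, fcCLM_apply, fc_expL2, smul_eq_mul, mul_ite, mul_one,
    mul_zero, Finset.sum_ite_eq]
  split_ifs with h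
  · rfl
  · have : m k = 0 := by simpa using h
    simp [this]

/-- Multiplication by continuous functions on `L²(𝕋)`. -/
def mulCLM : C(Torus, ℂ) →L[ℂ] L2T →L[ℂ] L2T :=
  ((ContinuousLinearMap.mul ℂ ℂ).holderL volume ⊤ 2 2) ∘L (ContinuousMap.toLp ⊤ volume ℂ)

theorem coeFn_mulCLM (φ : C(Torus, ℂ)) (v : L2T) :
    (mulCLM φ v : Torus → ℂ) =ᵐ[volume] fun x => φ x * v x := by
  have h := ContinuousLinearMap.coeFn_holder (r := 2) (ContinuousLinearMap.mul ℂ ℂ)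
    (ContinuousMap.toLp ⊤ (volume : Measure Torus) ℂ φ) v
  filter_upwards [h, ContinuousMap.coeFn_toLp (p := ⊤) (𝕜 := ℂ) (volume : Measure Torus) φ]
    with x hx hx'
  rw [hx'] at hx
  exact hx

theorem fc_mulCLM_fourier (j n : ℤ) (v : L2T) : fc (mulCLM (fourier j) v) n = fc v (n - j) := by
  rw [fc_congr_ae (coeFn_mulCLM _ v)]
  unfold fc
  congr 2
  ext x
  rw [← mul_assoc, ← fourier_add]
  congr 2
  ring_nf

theorem gMulNormSq_eq (g : Torus → ℝ) (φ : C(Torus, ℂ)) (hφ : ∀ x, φ x = g x) (v : L2T) :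
    gMulNormSq g v = ‖mulCLM φ v‖ ^ 2 := by
  rw [gMulNormSq, norm_sq_eq_integral_norm_sq]
  refine integral_congr_ae ?_
  filter_upwards [coeFn_mulCLM φ v] with x hx
  rw [hx, hφ]

theorem norm_sq_le_of_norm_fc_sq_le {u v : L2T} {c : ℝ} (j : ℤ)
    (h : ∀ k, ‖fc u k‖ ^ 2 ≤ c * ‖fc v (k - j)‖ ^ 2) : ‖u‖ ^ 2 ≤ c * ‖v‖ ^ 2 := by
  have h1 := hasSum_sq_fc u
  have h2 := ((Equiv.subRight j).hasSum_iff.mpr (hasSum_sq_fc v)).mul_left c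
  have h3 := hasSum_le h h1 h2
  have hpi : 0 < (2 * π)⁻¹ := by positivity
  nlinarith

theorem IsSemiGroup.norm_fc_eq {h : ℝ} {S : ℝ → L2T →L[ℂ] L2T} (hS : IsSemiGroup h S) {u : L2T}
    (hu : MeanZero u) (t : ℝ) (k : ℤ) : ‖fc (S t u) k‖ = ‖fc u k‖ := by
  obtain ⟨h0, hk⟩ := hS t u hu
  rcases eq_or_ne k 0 with rfl | hne
  · rw [h0, hu]
  · rw [hk k hne, norm_mul]
    have : Complex.I * (t : ℂ) * ((h : ℂ) ^ 2 * (k : ℂ) ^ 3 - 1 / ((h : ℂ) ^ 2 * (k : ℂ)))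
        = ((t * (h ^ 2 * k ^ 3 - 1 / (h ^ 2 * k)) : ℝ) : ℂ) * Complex.I := by
      push_cast
      ring
    rw [this, Complex.norm_exp_ofReal_mul_I, one_mul]

theorem IsSemiGroup.norm_eq {h : ℝ} {S : ℝ → L2T →L[ℂ] L2T} (hS : IsSemiGroup h S) {u : L2T}
    (hu : MeanZero u) (t : ℝ) : ‖S t u‖ ^ 2 = ‖u‖ ^ 2 := by
  have h1 := hasSum_sq_fc (S t u)
  simp only [hS.norm_fc_eq hu] at h1
  have := h1.unique (hasSum_sq_fc u)
  exact mul_left_cancel₀ (by positivity) this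

theorem IsSemiGroup.continuous {h : ℝ} {S : ℝ → L2T →L[ℂ] L2T} (hS : IsSemiGroup h S) {u : L2T}
    (hu : MeanZero u) : Continuous fun t => S t u := by
  have hcoef : ∀ k : ℤ, Continuous fun t => fc (S t u) k := by
    intro k
    rcases eq_or_ne k 0 with rfl | hne
    · have : ∀ t, fc (S t u) 0 = 0 := fun t => (hS t u hu).1
      simp only [this]
      exact continuous_const
    · have : ∀ t, fc (S t u) k = _ := fun t => (hS t u hu).2 k hne
      simp only [this]
      fun_prop
  rw [continuous_iff_continuousAt]
  intro s
  have hsub : ∀ t k, fc (S t u - S s u : L2T) k = fc (S t u) k - fc (S s u) k := fun t k => by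
    simp only [← fcCLM_apply, map_sub]
  have hlim : Tendsto (fun t => ∑' k : ℤ, ‖fc (S t u - S s u : L2T) k‖ ^ 2) (nhds s)
      (nhds (∑' _ : ℤ, (0 : ℝ))) := by
    refine tendsto_tsum_of_dominated_convergence
      (bound := fun k => 4 * ‖fc u k‖ ^ 2) ((hasSum_sq_fc u).summable.mul_left 4) ?_ ?_
    · intro k
      simp only [hsub]
      have : Continuous fun t => ‖fc (S t u) k - fc (S s u) k‖ ^ 2 :=
        (((hcoef k).sub continuous_const).norm).pow 2
      simpa using this.tendsto s
    · refine Eventually.of_forall fun t k => ?_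
      rw [hsub, Real.norm_of_nonneg (by positivity)]
      have h1 := norm_sub_le (fc (S t u) k) (fc (S s u) k)
      rw [hS.norm_fc_eq hu, hS.norm_fc_eq hu] at h1
      nlinarith [norm_nonneg (fc (S t u) k - fc (S s u) k), norm_nonneg (fc u k)]
  simp only [(hasSum_sq_fc _).tsum_eq, tsum_zero] at hlim
  have hlim2 : Tendsto (fun t => ‖S t u - S s u‖ ^ 2) (nhds s) (nhds 0) := by
    have := hlim.const_mul (2 * π)
    rw [mul_zero] at this
    refine this.congr fun t => ?_
    rw [mul_inv_cancel_left₀ (by positivity)]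
  rw [ContinuousAt, tendsto_iff_norm_sub_tendsto_zero]
  have := hlim2.sqrt
  simpa [Real.sqrt_sq (norm_nonneg _)] using this

/-- The commutator of the Fourier multiplier `M`, whose symbol is `1/2`-Hölder with constant `κ`,
with the multiplication by `φ`. -/
theorem norm_commutator_le {φ : C(Torus, ℂ)} {A : ℝ}
    (hφ : HasSum (fun j => fourierCoeff φ j • (fourier j : C(Torus, ℂ))) φ)
    (hA : HasSum (fun j : ℤ => ‖fourierCoeff φ j‖ * √|(j : ℝ)|) A)
    {m : ℤ → ℝ} {κ : ℝ} (hκ : 0 ≤ κ) (hm : ∀ n j : ℤ, (m (n - j) - m n) ^ 2 ≤ κ * |(j : ℝ)|)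
    {M : L2T →L[ℂ] L2T} (hM : ∀ (u : L2T) (k : ℤ), fc (M u) k = (m k : ℂ) * fc u k) (v : L2T) :
    ‖mulCLM φ (M v) - M (mulCLM φ v)‖ ≤ √κ * A * ‖v‖ := by
  have hsum : HasSum (fun j : ℤ => fourierCoeff φ j •
      (mulCLM (fourier j) (M v) - M (mulCLM (fourier j) v)))
      (mulCLM φ (M v) - M (mulCLM φ v)) := by
    have h1 := ((mulCLM.flip (M v)) - M ∘L (mulCLM.flip v)).hasSum hφ
    simpa using h1
  have hA' : HasSum (fun j : ℤ => √κ * (‖fourierCoeff φ j‖ * √|(j : ℝ)|) * ‖v‖) (√κ * A * ‖v‖) :=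
    (hA.mul_left _).mul_right _
  refine hsum.norm_le_of_bounded hA' fun j => ?_
  rw [norm_smul]
  have key : ‖mulCLM (fourier j) (M v) - M (mulCLM (fourier j) v)‖ ^ 2
      ≤ (κ * |(j : ℝ)|) * ‖v‖ ^ 2 := by
    refine norm_sq_le_of_norm_fc_sq_le j fun n => ?_
    rw [← fcCLM_apply, map_sub, fcCLM_apply, fcCLM_apply, fc_mulCLM_fourier, hM, hM,
      fc_mulCLM_fourier, ← sub_mul, norm_mul, mul_pow, ← Complex.ofReal_sub, Complex.norm_real,
      Real.norm_eq_abs, sq_abs]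
    gcongr
    exact hm n j
  have key2 : ‖mulCLM (fourier j) (M v) - M (mulCLM (fourier j) v)‖ ≤ √κ * √|(j : ℝ)| * ‖v‖ := by
    refine le_of_sq_le_sq ?_ (by positivity)
    rw [mul_pow, mul_pow, Real.sq_sqrt hκ, Real.sq_sqrt (abs_nonneg _)]
    exact key
  calc _ ≤ ‖fourierCoeff φ j‖ * (√κ * √|(j : ℝ)| * ‖v‖) := by gcongr
    _ = _ := by ring

theorem norm_fourierCoeffOn_le {a b : ℝ} (hab : a < b) {f : ℝ → ℂ} {D : ℝ}
    (hD : ∀ x ∈ Set.uIcc a b, ‖f x‖ ≤ D) (n : ℤ) : ‖fourierCoeffOn hab f n‖ ≤ D := by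
  rw [fourierCoeffOn_eq_integral, norm_smul]
  have h := intervalIntegral.norm_integral_le_of_norm_le_const (a := a) (b := b) (C := D)
    (f := fun x => fourier (-n) (x : AddCircle (b - a)) • f x) (fun x hx => by
      rw [norm_smul, fourier_apply, Circle.norm_coe, one_mul]
      exact hD x (Set.uIoc_subset_uIcc hx))
  have hba : 0 < b - a := by linarith
  rw [abs_of_pos hba] at h
  rw [Real.norm_of_nonneg (by positivity)]
  calc _ ≤ 1 / (b - a) * (D * (b - a)) := by gcongr
    _ = D := by field_simp

theorem norm_fourierCoeffOn_eq_deriv {T : ℝ} (hT : 0 < T) {f : ℝ → ℂ} (hf : ContDiff ℝ 1 f)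
    (hper : Function.Periodic f T) {n : ℤ} (hn : n ≠ 0) :
    ‖fourierCoeffOn (lt_add_of_pos_right (0 : ℝ) hT) f n‖
      = T / (2 * π) * |(n : ℝ)|⁻¹ *
        ‖fourierCoeffOn (lt_add_of_pos_right (0 : ℝ) hT) (deriv f) n‖ := by
  rw [fourierCoeffOn_of_hasDerivAt (f' := deriv f) _ hn
    (fun x _ => (hf.differentiable (by simp) x).hasDerivAt)
    ((hf.continuous_deriv le_rfl).intervalIntegrable _ _), hper 0, sub_self, mul_zero, zero_sub]
  simp only [zero_add, Complex.ofReal_zero, sub_zero, norm_mul, norm_neg, norm_div, norm_one,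
    Complex.norm_real, Complex.norm_I, Complex.norm_ofNat, Complex.norm_intCast,
    Real.norm_eq_abs, abs_of_pos hT, abs_of_pos Real.pi_pos]
  have : (0 : ℝ) < |(n : ℝ)| := by positivity
  field_simp

theorem exists_bound_fourierCoeffOn {T : ℝ} (hT : 0 < T) {f : ℝ → ℂ} (hf : ContDiff ℝ 2 f)
    (hper : Function.Periodic f T) :
    ∃ D : ℝ, ∀ n : ℤ, n ≠ 0 →
      ‖fourierCoeffOn (lt_add_of_pos_right (0 : ℝ) hT) f n‖ ≤ D * |(n : ℝ)| ^ (-2 : ℝ) := by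
  have hf1 : ContDiff ℝ 1 (deriv f) := hf.deriv' (n := 1)
  have hf2 : Continuous (deriv (deriv f)) := hf1.continuous_deriv le_rfl
  have hper1 : Function.Periodic (deriv f) T := fun x => by
    rw [← deriv_comp_add_const, hper.funext]
  obtain ⟨D, hD⟩ := isCompact_uIcc.exists_bound_of_continuousOn
    (hf2.continuousOn (s := Set.uIcc 0 (0 + T)))
  refine ⟨(T / (2 * π)) ^ 2 * D, fun n hn => ?_⟩
  rw [norm_fourierCoeffOn_eq_deriv hT (hf.of_le (by norm_num)) hper hn,
    norm_fourierCoeffOn_eq_deriv hT hf1 hper1 hn]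
  have h := norm_fourierCoeffOn_le (lt_add_of_pos_right (0 : ℝ) hT) hD n
  rw [Real.rpow_neg (abs_nonneg _), Real.rpow_two]
  calc _ ≤ T / (2 * π) * |(n : ℝ)|⁻¹ * (T / (2 * π) * |(n : ℝ)|⁻¹ * D) := by gcongr
    _ = _ := by ring

/-- The Fourier series of a periodic `C²` function converges uniformly, and its coefficients are
summable against `|j|^{1/2}`. -/
theorem exists_hasSum_fourier {f : ℝ → ℂ} (hf : ContDiff ℝ 2 f)
    (hper : Function.Periodic f (2 * π)) {φ : C(Torus, ℂ)} (hφ : ∀ x, φ x = hper.lift x) :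
    HasSum (fun j => fourierCoeff φ j • (fourier j : C(Torus, ℂ))) φ ∧
      Summable (fun j : ℤ => ‖fourierCoeff φ j‖ * √|(j : ℝ)|) := by
  obtain ⟨D, hD⟩ := exists_bound_fourierCoeffOn Real.two_pi_pos hf hper
  have hcoef : ∀ n, fourierCoeff φ n
      = fourierCoeffOn (lt_add_of_pos_right (0 : ℝ) Real.two_pi_pos) f n := fun n => by
    rw [fourierCoeffOn_eq_integral, fourierCoeff_eq_intervalIntegral _ _ 0]
    simp only [hφ, Function.Periodic.lift_coe, fourier_coe_apply, zero_add, sub_zero]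
  simp only [← hcoef] at hD
  have hsum : Summable (fun j : ℤ => ‖fourierCoeff φ j‖ * √|(j : ℝ)|) := by
    refine Summable.of_nonneg_of_le (fun j => by positivity) (fun j => ?_)
      ((Real.summable_abs_int_rpow (b := 3 / 2) (by norm_num)).mul_left D)
    rcases eq_or_ne j 0 with rfl | hj
    · simp [Real.zero_rpow]
    · have hj' : (0 : ℝ) < |(j : ℝ)| := by positivity
      calc _ ≤ D * |(j : ℝ)| ^ (-2 : ℝ) * √|(j : ℝ)| := by gcongr; exact hD j hj
        _ = _ := by
          rw [Real.sqrt_eq_rpow, mul_assoc, ← Real.rpow_add hj']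
          norm_num
  refine ⟨hasSum_fourier_series_of_summable (.of_norm_bounded_eventually hsum ?_), hsum⟩
  rw [eventually_cofinite]
  refine (Set.finite_singleton (0 : ℤ)).subset fun j hj => ?_
  by_contra hne
  apply hj
  have : (1 : ℝ) ≤ |(j : ℝ)| := by exact_mod_cast Int.one_le_abs hne
  have : 1 ≤ √|(j : ℝ)| := Real.one_le_sqrt.mpr this
  nlinarith [norm_nonneg (fourierCoeff φ j)]

/-- At most three dyadic rescalings of a point meet the support of `ψ`. -/
theorem exists_dyadic_finset {ψ : ℝ → ℝ} (hψ : ∀ ξ : ℝ, ψ ξ ≠ 0 → 1/2 ≤ |ξ| ∧ |ξ| ≤ 2) {ξ : ℝ}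
    (hξ : ξ ≠ 0) : ∃ s : Finset ℤ, s.card ≤ 3 ∧ ∀ k : ℤ, ψ ((2:ℝ) ^ k * ξ) ≠ 0 → k ∈ s := by
  obtain ⟨n, hn1, hn2⟩ := exists_mem_Ico_zpow (abs_pos.mpr hξ) (one_lt_two (α := ℝ))
  refine ⟨Finset.Icc (-1 - n) (1 - n), by simp; lia, fun k hk => ?_⟩
  obtain ⟨h1, h2⟩ := hψ _ hk
  rw [abs_mul, abs_of_pos (by positivity)] at h1 h2
  have hk0 : (0 : ℝ) < 2 ^ k := by positivity
  have a1 : (2 : ℝ) ^ (k + n) ≤ 2 ^ (1 : ℤ) := by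
    rw [zpow_add₀ two_ne_zero]
    calc _ ≤ (2 : ℝ) ^ k * |ξ| := by gcongr
      _ ≤ _ := by simpa using h2
  have a2 : (2 : ℝ) ^ (-1 : ℤ) < 2 ^ (k + (n + 1)) := by
    rw [zpow_add₀ two_ne_zero k]
    calc _ ≤ (2 : ℝ) ^ k * |ξ| := by simpa using h1
      _ < _ := by gcongr
  rw [zpow_le_zpow_iff_right₀ one_lt_two] at a1
  rw [zpow_lt_zpow_iff_right₀ one_lt_two] at a2
  rw [Finset.mem_Icc]
  lia

theorem sum_sq_dyadic_le {ψ : ℝ → ℝ} (hψ : ∀ ξ : ℝ, ψ ξ ≠ 0 → 1/2 ≤ |ξ| ∧ |ξ| ≤ 2) {P : ℝ}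
    (hP : ∀ ξ, |ψ ξ| ≤ P) (F : Finset ℤ) (ξ : ℝ) :
    ∑ k ∈ F, ψ ((2:ℝ) ^ k * ξ) ^ 2 ≤ 3 * P ^ 2 := by
  rcases eq_or_ne ξ 0 with rfl | hξ
  · have : ψ 0 = 0 := by
      by_contra h
      have := (hψ 0 h).1
      norm_num at this
    simp only [mul_zero, this]
    simp
    positivity
  · obtain ⟨s, hs, hmem⟩ := exists_dyadic_finset hψ hξ
    calc ∑ k ∈ F, ψ ((2:ℝ) ^ k * ξ) ^ 2 ≤ ∑ k ∈ F ∪ s, ψ ((2:ℝ) ^ k * ξ) ^ 2 :=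
          Finset.sum_le_sum_of_subset_of_nonneg Finset.subset_union_left (by intros; positivity)
      _ = ∑ k ∈ s, ψ ((2:ℝ) ^ k * ξ) ^ 2 := by
          refine (Finset.sum_subset Finset.subset_union_right fun k _ hk => ?_).symm
          have := mt (hmem k) hk
          simpa using this
      _ ≤ ∑ k ∈ s, P ^ 2 := Finset.sum_le_sum fun k _ => by
          rw [← sq_abs]
          gcongr
          exact hP _
      _ ≤ 3 * P ^ 2 := by
          rw [Finset.sum_const, nsmul_eq_mul]
          gcongr
          exact_mod_cast hs

theorem one_le_sum_sq_dyadic {ψ : ℝ → ℝ} (hψ : ∀ ξ : ℝ, ψ ξ ≠ 0 → 1/2 ≤ |ξ| ∧ |ξ| ≤ 2)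
    {ξ : ℝ} (hξ : ξ ≠ 0) (hsum : ∑' k : ℤ, ψ ((2:ℝ) ^ k * ξ) = 1) :
    ∃ s : Finset ℤ, (∀ k ∈ s, ψ ((2:ℝ) ^ k * ξ) ≠ 0) ∧ 1 ≤ 3 * ∑ k ∈ s, ψ ((2:ℝ) ^ k * ξ) ^ 2 := by
  obtain ⟨s, hs, hmem⟩ := exists_dyadic_finset hψ hξ
  classical
  refine ⟨s.filter fun k => ψ ((2:ℝ) ^ k * ξ) ≠ 0, fun k hk => (Finset.mem_filter.mp hk).2, ?_⟩
  rw [tsum_eq_sum (s := s.filter fun k => ψ ((2:ℝ) ^ k * ξ) ≠ 0) fun k hk => by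
    by_contra h
    exact hk (Finset.mem_filter.mpr ⟨hmem k h, h⟩)] at hsum
  have h := sq_sum_le_card_mul_sum_sq (s := s.filter fun k => ψ ((2:ℝ) ^ k * ξ) ≠ 0)
    (f := fun k => ψ ((2:ℝ) ^ k * ξ))
  rw [hsum, one_pow] at h
  refine h.trans ?_
  gcongr
  exact_mod_cast (Finset.card_filter_le _ _).trans hs

theorem sum_zpow_mul_le {F : Finset ℤ} {h ε : ℝ} (hh : 0 < h) (hε : 0 ≤ ε)
    (hF : ∀ k ∈ F, (2:ℝ) ^ k * h ≤ ε) : ∑ k ∈ F, (2:ℝ) ^ k * h ≤ 2 * ε := by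
  induction F using Finset.induction_on_max generalizing ε with
  | empty => simpa using hε
  | insert a s hs ih =>
    rw [Finset.sum_insert fun ha => lt_irrefl a (hs a ha)]
    have ha := hF a (Finset.mem_insert_self a s)
    have := ih (ε := (2:ℝ) ^ a * h / 2) (by positivity) fun k hk => by
      have h1 : (2:ℝ) ^ (k + 1) ≤ 2 ^ a := zpow_le_zpow_right₀ one_le_two (hs k hk)
      rw [zpow_add_one₀ two_ne_zero] at h1
      nlinarith
    linarith

theorem exists_dyadic_multiplier {ψ : ℝ → ℝ} (hψ : ∀ ξ : ℝ, ψ ξ ≠ 0 → 1/2 ≤ |ξ| ∧ |ξ| ≤ 2)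
    {h : ℝ} (hh : 0 < h) (k : ℤ) :
    ∃ M : L2T →L[ℂ] L2T, IsMult (fun ξ => ψ ((2:ℝ) ^ k * ξ)) h M := by
  refine exists_multiplier (fun n : ℤ => ψ ((2:ℝ) ^ k * (h * n))) ?_
  refine (Set.finite_Icc (-⌈2 / (2 ^ k * h)⌉) ⌈2 / (2 ^ k * h)⌉).subset fun n hn => ?_
  have h2 := (hψ _ hn).2
  have hη : 0 < (2:ℝ) ^ k * h := by positivity
  rw [← mul_assoc, abs_mul, abs_of_pos hη, mul_comm, ← le_div_iff₀ hη] at h2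
  rw [Set.mem_Icc, ← abs_le]
  exact_mod_cast h2.trans (Int.le_ceil _)

theorem sum_norm_sq_dyadic_le {ψ : ℝ → ℝ} (hψ : ∀ ξ : ℝ, ψ ξ ≠ 0 → 1/2 ≤ |ξ| ∧ |ξ| ≤ 2) {P : ℝ}
    (hP : ∀ ξ, |ψ ξ| ≤ P) {h : ℝ} {M : ℤ → L2T →L[ℂ] L2T}
    (hM : ∀ k, IsMult (fun ξ => ψ ((2:ℝ) ^ k * ξ)) h (M k)) (F : Finset ℤ) (w : L2T) :
    ∑ k ∈ F, ‖M k w‖ ^ 2 ≤ 3 * P ^ 2 * ‖w‖ ^ 2 := by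
  have h1 := hasSum_sum fun k (_ : k ∈ F) => hasSum_sq_fc (M k w)
  have h2 := (hasSum_sq_fc w).mul_left (3 * P ^ 2)
  have h3 := hasSum_le (fun n => ?_) h1 h2
  · rw [← Finset.mul_sum] at h3
    have hpi : 0 < (2 * π)⁻¹ := by positivity
    nlinarith
  · have : ∀ k, ‖fc (M k w) n‖ ^ 2 = ψ ((2:ℝ) ^ k * (h * n)) ^ 2 * ‖fc w n‖ ^ 2 := fun k => by
      rw [hM k, norm_mul, mul_pow, Complex.norm_real, Real.norm_eq_abs, sq_abs]
    simp only [this, ← Finset.sum_mul]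
    gcongr
    exact sum_sq_dyadic_le hψ hP F _

/-- The high frequencies are controlled by the Littlewood-Paley pieces, the low ones by the
`H⁻¹` norm. -/
theorem norm_sq_le_of_dyadic_bound {ψ : ℝ → ℝ} (hψ : ∀ ξ : ℝ, ψ ξ ≠ 0 → 1/2 ≤ |ξ| ∧ |ξ| ≤ 2)
    (hsum : ∀ ξ : ℝ, ξ ≠ 0 → ∑' k : ℤ, ψ ((2:ℝ) ^ k * ξ) = 1) {h : ℝ} (hh : 0 < h)
    {M : ℤ → L2T →L[ℂ] L2T} (hM : ∀ k, IsMult (fun ξ => ψ ((2:ℝ) ^ k * ξ)) h (M k))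
    {ε R : ℝ} (hε : 0 < ε) (u : L2T)
    (hR : ∀ F : Finset ℤ, (∀ k ∈ F, (2:ℝ) ^ k * h ≤ ε) → ∑ k ∈ F, ‖M k u‖ ^ 2 ≤ R) :
    ‖u‖ ^ 2 ≤ 2 * π * (1 + (2 / ε) ^ 2) * Hneg1Sq u + 3 * R := by
  classical
  have hHs : Summable fun n : ℤ => (1 + (n : ℝ) ^ 2)⁻¹ * ‖fc u n‖ ^ 2 := by
    refine Summable.of_nonneg_of_le (fun n => by positivity) (fun n => ?_) (hasSum_sq_fc u).summable
    exact mul_le_of_le_one_left (by positivity)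
      (inv_le_one_of_one_le₀ (by nlinarith [sq_nonneg (n : ℝ)]))
  have hfin : ∀ A : Finset ℤ,
      ∑ n ∈ A, ‖fc u n‖ ^ 2 ≤ (1 + (2 / ε) ^ 2) * Hneg1Sq u + 3 * ((2 * π)⁻¹ * R) := by
    intro A
    have hs : ∀ n : ℤ, ∃ s : Finset ℤ, (2 / ε ≤ |(n : ℝ)| → (∀ k ∈ s, (2:ℝ) ^ k * h ≤ ε) ∧
        1 ≤ 3 * ∑ k ∈ s, ψ ((2:ℝ) ^ k * (h * n)) ^ 2) ∧ (|(n : ℝ)| < 2 / ε → s = ∅) := by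
      intro n
      by_cases hn : 2 / ε ≤ |(n : ℝ)|
      · have hn0 : 0 < |(n : ℝ)| := lt_of_lt_of_le (by positivity) hn
        have hξ : h * (n : ℝ) ≠ 0 := mul_ne_zero hh.ne' (abs_pos.mp hn0)
        obtain ⟨s, hs1, hs2⟩ := one_le_sum_sq_dyadic hψ hξ (hsum _ hξ)
        refine ⟨s, fun _ => ⟨fun k hk => ?_, hs2⟩, fun h' => absurd hn h'.not_ge⟩
        have h2 := (hψ _ (hs1 k hk)).2
        rw [← mul_assoc, abs_mul, abs_of_pos (by positivity : 0 < (2:ℝ) ^ k * h)] at h2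
        rw [div_le_iff₀ hε] at hn
        by_contra! hlt
        nlinarith
      · exact ⟨∅, fun h' => absurd h' hn, fun _ => rfl⟩
    choose s hs using hs
    let F := A.biUnion s
    have hF : ∀ k ∈ F, (2:ℝ) ^ k * h ≤ ε := fun k hk => by
      obtain ⟨n, _, hk⟩ := Finset.mem_biUnion.mp hk
      by_cases hn : 2 / ε ≤ |(n : ℝ)|
      · exact ((hs n).1 hn).1 k hk
      · simp [(hs n).2 (not_le.mp hn)] at hk
    have hpt : ∀ n ∈ A, ‖fc u n‖ ^ 2 ≤ (1 + (2 / ε) ^ 2) * ((1 + (n : ℝ) ^ 2)⁻¹ * ‖fc u n‖ ^ 2)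
        + 3 * ∑ k ∈ F, ‖fc (M k u) n‖ ^ 2 := by
      intro n hnA
      by_cases hn : 2 / ε ≤ |(n : ℝ)|
      · have hle : 1 ≤ 3 * ∑ k ∈ F, ψ ((2:ℝ) ^ k * (h * n)) ^ 2 :=
          ((hs n).1 hn).2.trans <| by
            gcongr
            exact Finset.subset_biUnion_of_mem s hnA
        have : ∀ k, ‖fc (M k u) n‖ ^ 2 = ψ ((2:ℝ) ^ k * (h * n)) ^ 2 * ‖fc u n‖ ^ 2 := fun k => by
          rw [hM k, norm_mul, mul_pow, Complex.norm_real, Real.norm_eq_abs, sq_abs]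
        simp only [this, ← Finset.sum_mul]
        have h0 : 0 ≤ (1 + (2 / ε) ^ 2) * ((1 + (n : ℝ) ^ 2)⁻¹ * ‖fc u n‖ ^ 2) := by positivity
        nlinarith [sq_nonneg ‖fc u n‖]
      · have h1 : (n : ℝ) ^ 2 ≤ (2 / ε) ^ 2 := by
          rw [← sq_abs]
          gcongr
          exact (not_le.mp hn).le
        have h0 : 0 ≤ 3 * ∑ k ∈ F, ‖fc (M k u) n‖ ^ 2 := by positivity
        have h2 : 1 ≤ (1 + (2 / ε) ^ 2) * (1 + (n : ℝ) ^ 2)⁻¹ := by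
          rw [← div_eq_mul_inv, one_le_div (by positivity)]
          linarith
        rw [← mul_assoc]
        nlinarith [sq_nonneg ‖fc u n‖]
    refine (Finset.sum_le_sum hpt).trans ?_
    rw [Finset.sum_add_distrib, ← Finset.mul_sum, ← Finset.mul_sum, Finset.sum_comm]
    gcongr
    · exact hHs.sum_le_tsum A fun n _ => by positivity
    · calc _ ≤ ∑ k ∈ F, (2 * π)⁻¹ * ‖M k u‖ ^ 2 := Finset.sum_le_sum fun k _ =>
            sum_le_hasSum A (fun n _ => by positivity) (hasSum_sq_fc (M k u))
        _ ≤ _ := by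
          rw [← Finset.mul_sum]
          gcongr
          exact hR F hF
  have hfinal := hasSum_le_of_sum_le (hasSum_sq_fc u) hfin
  have hpi : 0 < 2 * π := by positivity
  rw [inv_mul_le_iff₀ hpi] at hfinal
  refine hfinal.trans (le_of_eq ?_)
  field_simp

/-- Commuting the Littlewood-Paley pieces with the multiplication by `φ` and summing. -/
theorem sum_norm_sq_mul_dyadic_le {ψ : ℝ → ℝ} (hψ : ∀ ξ : ℝ, ψ ξ ≠ 0 → 1/2 ≤ |ξ| ∧ |ξ| ≤ 2)
    {P L : ℝ} (hP : ∀ ξ, |ψ ξ| ≤ P) (hL0 : 0 ≤ L) (hL : ∀ x y, |ψ x - ψ y| ≤ L * |x - y|)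
    {φ : C(Torus, ℂ)} {A : ℝ}
    (hφ : HasSum (fun j => fourierCoeff φ j • (fourier j : C(Torus, ℂ))) φ)
    (hA : HasSum (fun j : ℤ => ‖fourierCoeff φ j‖ * √|(j : ℝ)|) A)
    {h : ℝ} (hh : 0 < h) {M : ℤ → L2T →L[ℂ] L2T}
    (hM : ∀ k, IsMult (fun ξ => ψ ((2:ℝ) ^ k * ξ)) h (M k)) {ε : ℝ} (hε : 0 ≤ ε) {F : Finset ℤ}
    (hF : ∀ k ∈ F, (2:ℝ) ^ k * h ≤ ε) (v : L2T) :
    ∑ k ∈ F, ‖mulCLM φ (M k v)‖ ^ 2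
      ≤ 6 * P ^ 2 * ‖mulCLM φ v‖ ^ 2 + 8 * P * L * A ^ 2 * ε * ‖v‖ ^ 2 := by
  have hP0 : 0 ≤ P := (abs_nonneg _).trans (hP 0)
  have hk : ∀ k ∈ F, ‖mulCLM φ (M k v)‖ ^ 2 ≤
      2 * ‖M k (mulCLM φ v)‖ ^ 2 + 4 * P * L * A ^ 2 * ‖v‖ ^ 2 * ((2:ℝ) ^ k * h) := by
    intro k _
    have hη : 0 < (2:ℝ) ^ k * h := by positivity
    have hm : ∀ n j : ℤ, (ψ ((2:ℝ) ^ k * (h * (n - j : ℤ))) - ψ ((2:ℝ) ^ k * (h * n))) ^ 2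
        ≤ 2 * P * L * ((2:ℝ) ^ k * h) * |(j : ℝ)| := by
      intro n j
      have h1 := hL ((2:ℝ) ^ k * (h * (n - j : ℤ))) ((2:ℝ) ^ k * (h * n))
      have h2 : |(2:ℝ) ^ k * (h * (n - j : ℤ)) - (2:ℝ) ^ k * (h * n)|
          = (2:ℝ) ^ k * h * |(j : ℝ)| := by
        have : (2:ℝ) ^ k * (h * (n - j : ℤ)) - (2:ℝ) ^ k * (h * n) = -((2:ℝ) ^ k * h * j) := by
          push_cast
          ring
        rw [this, abs_neg, abs_mul, abs_of_pos hη]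
      rw [h2] at h1
      have h3 := (abs_sub (ψ ((2:ℝ) ^ k * (h * (n - j : ℤ)))) (ψ ((2:ℝ) ^ k * (h * n)))).trans
        (add_le_add (hP _) (hP _))
      rw [← sq_abs, sq]
      calc _ ≤ (P + P) * (L * ((2:ℝ) ^ k * h * |(j : ℝ)|)) :=
            mul_le_mul h3 h1 (abs_nonneg _) (by positivity)
        _ = _ := by ring
    have hc := norm_commutator_le hφ hA (by positivity) hm (hM k) v
    have ht := norm_le_norm_add_norm_sub' (mulCLM φ (M k v)) (M k (mulCLM φ v))
    have hsq : ‖mulCLM φ (M k v) - M k (mulCLM φ v)‖ ^ 2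
        ≤ 2 * P * L * ((2:ℝ) ^ k * h) * A ^ 2 * ‖v‖ ^ 2 := by
      refine (pow_le_pow_left₀ (norm_nonneg _) hc 2).trans (le_of_eq ?_)
      rw [mul_pow, mul_pow, Real.sq_sqrt (by positivity)]
    nlinarith [norm_nonneg (mulCLM φ (M k v)), pow_le_pow_left₀ (norm_nonneg _) ht 2,
      sq_nonneg (‖M k (mulCLM φ v)‖ - ‖mulCLM φ (M k v) - M k (mulCLM φ v)‖)]
  refine (Finset.sum_le_sum hk).trans ?_
  rw [Finset.sum_add_distrib, ← Finset.mul_sum, ← Finset.mul_sum]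
  have h1 := sum_norm_sq_dyadic_le hψ hP hM F (mulCLM φ v)
  have h2 := mul_le_mul_of_nonneg_left (sum_zpow_mul_le hh hε hF)
    (by positivity : 0 ≤ 4 * P * L * A ^ 2 * ‖v‖ ^ 2)
  linarith

/-- Lemma 3.9, frequency-localized observability implies semiclassical
observability: if the Littlewood-Paley pieces `ψ_k(hDₓ)` satisfy the frequency-localized
observability inequality at time `T₀`, then the semiclassical weak observability inequality
`‖u₀‖² ≤ C ∫₀^{T₀} ‖g·Sʰ(t)u₀‖² dt + C ‖u₀‖²_{H⁻¹}` holds uniformly for small `h`. -/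
theorem frequency_localized_implies_semiclassical_observability
    -- `g` is a fixed real-valued C² function on `𝕋` (2π-periodic on `ℝ`), nonnegative,
    -- with integral 1, vanishing outside `(a,b) ⊂ (-π,π)`:
    (g : ℝ → ℝ) (hg_reg : ContDiff ℝ 2 g) (hg_per : Function.Periodic g (2 * Real.pi))
    (hg_nonneg : ∀ x, 0 ≤ g x)
    (a b : ℝ) (ha : -Real.pi < a) (hab : a < b) (hb : b < Real.pi)
    (hg_supp : ∀ x ∈ Set.Ioc (-Real.pi) Real.pi, g x ≠ 0 → x ∈ Set.Ioo a b)
    (hg_int : ∫ x in (-Real.pi)..Real.pi, g x = 1)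
    (ψ : ℝ → ℝ) (hψ_reg : ContDiff ℝ (⊤ : ℕ∞) ψ) (hψ_cpt : HasCompactSupport ψ)
    (hψ_supp : ∀ ξ : ℝ, ψ ξ ≠ 0 → 1/2 ≤ |ξ| ∧ |ξ| ≤ 2)
    (hψ_sum : ∀ ξ : ℝ, ξ ≠ 0 → ∑' k : ℤ, ψ ((2:ℝ) ^ k * ξ) = 1)
    (T₀ : ℝ) (hT₀ : 0 < T₀)
    (hloc : ∀ ε₀ ∈ Set.Ioo (0:ℝ) 1, ∃ h₀ ∈ Set.Ioo (0:ℝ) 1, ∃ C₀ : ℝ, 0 < C₀ ∧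
      ∀ k : ℤ, ∀ h : ℝ, 0 < h → h < h₀ → (2:ℝ) ^ k * h ≤ ε₀ →
        ∀ M : L2T →L[ℂ] L2T, IsMult (fun ξ => ψ ((2:ℝ) ^ k * ξ)) h M →
          ∀ S : ℝ → L2T →L[ℂ] L2T, IsSemiGroup h S →
            ∀ u₀ : L2T, MeanZero u₀ →
              ‖M u₀‖ ^ 2 ≤ C₀ * ∫ t in (0:ℝ)..T₀, gMulNormSq hg_per.lift (M (S t u₀))) :
    ∃ C : ℝ, 0 < C ∧ ∃ h₁ ∈ Set.Ioo (0:ℝ) 1,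
      ∀ h : ℝ, 0 < h → h < h₁ →
        ∀ S : ℝ → L2T →L[ℂ] L2T, IsSemiGroup h S →
          ∀ u₀ : L2T, MeanZero u₀ →
            ‖u₀‖ ^ 2 ≤ C * (∫ t in (0:ℝ)..T₀, gMulNormSq hg_per.lift (S t u₀))
              + C * Hneg1Sq u₀ := by
  obtain ⟨P, hP⟩ := hψ_cpt.exists_bound_of_continuous hψ_reg.continuous
  obtain ⟨L, hL⟩ := hψ_reg.lipschitzWith_of_hasCompactSupport hψ_cpt (by simp)
  have hL' : ∀ x y, |ψ x - ψ y| ≤ L * |x - y| := fun x y => by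
    simpa [Real.dist_eq] using hL.dist_le_mul x y
  have hP0 : 0 ≤ P := (norm_nonneg _).trans (hP 0)
  have hgc : ContDiff ℝ 2 fun x => (g x : ℂ) := Complex.ofRealCLM.contDiff.comp hg_reg
  have hgp : Function.Periodic (fun x => (g x : ℂ)) (2 * π) := fun x => by simp only [hg_per x]
  let φ : C(Torus, ℂ) := ⟨hgp.lift, continuous_coinduced_dom.mpr hgc.continuous⟩
  have hφg : ∀ x, φ x = hg_per.lift x := fun x => by
    induction x using QuotientAddGroup.induction_on with
    | H x => rfl
  obtain ⟨hφ, A, hA⟩ := exists_hasSum_fourier hgc hgp (φ := φ) fun _ => rfl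
  obtain ⟨h₀, hh₀, C₀, hC₀, hobs⟩ := hloc (1 / 2) (by norm_num)
  simp only [gMulNormSq_eq _ φ hφg] at hobs ⊢
  obtain ⟨Q, hQ⟩ : ∃ Q, Q = 24 * C₀ * P * L * A ^ 2 * T₀ := ⟨_, rfl⟩
  have hQ0 : 0 ≤ Q := by rw [hQ]; positivity
  obtain ⟨ε, hε⟩ : ∃ ε, ε = 1 / (2 * (Q + 1)) := ⟨_, rfl⟩
  have hε0 : 0 < ε := by rw [hε]; positivity
  have hεQ : ε * (2 * (Q + 1)) = 1 := by rw [hε]; field_simp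
  have hε1 : ε ≤ 1 / 2 := by nlinarith
  refine ⟨4 * π * (1 + (2 / ε) ^ 2) + 36 * C₀ * P ^ 2, by positivity, h₀, hh₀, ?_⟩
  intro h hh hlt S hS u hu
  choose M hM using exists_dyadic_multiplier hψ_supp hh
  have hcont := hS.continuous hu
  obtain ⟨I, hI⟩ : ∃ I, I = ∫ t in (0:ℝ)..T₀, ‖mulCLM φ (S t u)‖ ^ 2 := ⟨_, rfl⟩
  rw [← hI]
  have hI0 : 0 ≤ I := by
    rw [hI]
    exact intervalIntegral.integral_nonneg hT₀.le fun t _ => by positivity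
  have hR : ∀ F : Finset ℤ, (∀ k ∈ F, (2:ℝ) ^ k * h ≤ ε) → ∑ k ∈ F, ‖M k u‖ ^ 2 ≤
      C₀ * (6 * P ^ 2 * I + T₀ * (8 * P * L * A ^ 2 * ε * ‖u‖ ^ 2)) := by
    intro F hF
    calc ∑ k ∈ F, ‖M k u‖ ^ 2
        ≤ ∑ k ∈ F, C₀ * ∫ t in (0:ℝ)..T₀, ‖mulCLM φ (M k (S t u))‖ ^ 2 :=
          Finset.sum_le_sum fun k hk =>
            hobs k h hh hlt ((hF k hk).trans hε1) (M k) (hM k) S hS u hu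
      _ = C₀ * ∫ t in (0:ℝ)..T₀, ∑ k ∈ F, ‖mulCLM φ (M k (S t u))‖ ^ 2 := by
          rw [← Finset.mul_sum, intervalIntegral.integral_finsetSum]
          exact fun k _ => Continuous.intervalIntegrable (by fun_prop) _ _
      _ ≤ C₀ * ∫ t in (0:ℝ)..T₀, (6 * P ^ 2 * ‖mulCLM φ (S t u)‖ ^ 2
            + 8 * P * L * A ^ 2 * ε * ‖u‖ ^ 2) := by
          refine mul_le_mul_of_nonneg_left (intervalIntegral.integral_mono_on hT₀.le
            (Continuous.intervalIntegrable (by fun_prop) _ _)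
            (Continuous.intervalIntegrable (by fun_prop) _ _) fun t _ => ?_) hC₀.le
          rw [← hS.norm_eq hu t]
          exact sum_norm_sq_mul_dyadic_le hψ_supp hP L.coe_nonneg hL' hφ hA hh hM hε0.le hF (S t u)
      _ = _ := by
          rw [intervalIntegral.integral_add
            (Continuous.intervalIntegrable (by fun_prop) _ _)
            (Continuous.intervalIntegrable (by fun_prop) _ _),
            intervalIntegral.integral_const_mul, intervalIntegral.integral_const, ← hI]
          simp
  have hmain := norm_sq_le_of_dyadic_bound hψ_supp hψ_sum hh hM hε0 u hR
  have hH0 : 0 ≤ Hneg1Sq u := tsum_nonneg fun n => by positivity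
  have habs : 3 * (C₀ * (T₀ * (8 * P * L * A ^ 2 * ε * ‖u‖ ^ 2))) ≤ 1 / 2 * ‖u‖ ^ 2 := by
    calc _ = ε * Q * ‖u‖ ^ 2 := by rw [hQ]; ring
      _ ≤ _ := by gcongr; nlinarith
  have h1 : 0 ≤ 4 * π * (1 + (2 / ε) ^ 2) * I := by positivity
  have h2 : 0 ≤ 36 * C₀ * P ^ 2 * Hneg1Sq u := by positivity
  linarith
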